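/- Fix integers k ≥ 1, l with 0 ≤ l ≤ k, and r with 0 ≤ r ≤ k. Then the restriction map f ↦ (f|_{ℤ_{≥1}}, f|_{ℤ_{<0}}) is a bijection from {f ∈ Σ_{l,k} : f(0) = r} onto Σ_k^{+,k−r} × Σ_{l,k}^{−,k−r}, and it satisfies w(f) = w⁺(f|_{ℤ_{≥1}}) + w⁻(f|_{ℤ_{<0}}) for every such f. -/

import Mathlib

/-- An `(l,k)`-configuration: `f : ℤ → ℕ` with `f(m) + f(m+1) ≤ k` for all `m`,
`f(2m) = l`, `f(2m+1) = k − l` for all sufficiently negative `m`, and `f(m) = 0`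
for all sufficiently large `m`. -/
def FullConf (k l : ℕ) (f : ℤ → ℕ) : Prop :=
  (∀ m : ℤ, f m + f (m + 1) ≤ k) ∧
  (∃ M : ℤ, ∀ m : ℤ, m ≤ M → f (2 * m) = l ∧ f (2 * m + 1) = k - l) ∧
  (∃ M : ℤ, ∀ m : ℤ, M ≤ m → f m = 0)

/-- The weight
`w(f) = −∑_{m<0}(2m+1)(k−l−f(2m+1)) − ∑_{m<0}2m(l−f(2m)) + ∑_{m≥0} m·f(m)`
(all sums finite for configurations). -/
noncomputable def wFull (k l : ℕ) (f : ℤ → ℕ) : ℤ :=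
  -(∑ᶠ m ∈ {m : ℤ | m < 0}, (2 * m + 1) * ((k : ℤ) - (l : ℤ) - (f (2 * m + 1) : ℤ)))
  - (∑ᶠ m ∈ {m : ℤ | m < 0}, (2 * m) * ((l : ℤ) - (f (2 * m) : ℤ)))
  + ∑ᶠ m ∈ {m : ℤ | 0 ≤ m}, m * (f m : ℤ)

/-- Membership in `Σ_k^{+,s}`: a function on `ℤ_{≥1}` (encoded as a function on `ℤ`
vanishing on `m ≤ 0`) with `g(1) ≤ s`, `g(m) + g(m+1) ≤ k` for `m ≥ 1`, and `g(m) = 0`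
for all sufficiently large `m`. -/
def PlusConf (k s : ℕ) (g : ℤ → ℕ) : Prop :=
  (∀ m : ℤ, m ≤ 0 → g m = 0) ∧ g 1 ≤ s ∧
  (∀ m : ℤ, 1 ≤ m → g m + g (m + 1) ≤ k) ∧
  (∃ M : ℤ, ∀ m : ℤ, M ≤ m → g m = 0)

/-- The weight `w⁺(g) = ∑_{m≥1} m·g(m)` (a finite sum for configurations). -/
noncomputable def wPlus (g : ℤ → ℕ) : ℤ :=
  ∑ᶠ m ∈ {m : ℤ | 1 ≤ m}, m * (g m : ℤ)

/-- Membership in `Σ_{l,k}^{−,s}`: a function on `ℤ_{<0}` (encoded as a function on `ℤ`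
vanishing on `m ≥ 0`) with `h(−1) ≤ s`, `h(m) + h(m+1) ≤ k` for `m ≤ −2`, and
`h(2m) = l`, `h(2m+1) = k − l` for all sufficiently negative `m`. -/
def MinusConf (k l s : ℕ) (h : ℤ → ℕ) : Prop :=
  (∀ m : ℤ, 0 ≤ m → h m = 0) ∧ h (-1) ≤ s ∧
  (∀ m : ℤ, m ≤ -2 → h m + h (m + 1) ≤ k) ∧
  (∃ M : ℤ, ∀ m : ℤ, m ≤ M → h (2 * m) = l ∧ h (2 * m + 1) = k - l)

/-- The weight `w⁻(h) = −∑_{m<0}(2m+1)(k−l−h(2m+1)) − ∑_{m<0}2m(l−h(2m))`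
(a finite sum for configurations). -/
noncomputable def wMinus (k l : ℕ) (h : ℤ → ℕ) : ℤ :=
  -(∑ᶠ m ∈ {m : ℤ | m < 0}, (2 * m + 1) * ((k : ℤ) - (l : ℤ) - (h (2 * m + 1) : ℤ)))
  - ∑ᶠ m ∈ {m : ℤ | m < 0}, (2 * m) * ((l : ℤ) - (h (2 * m) : ℤ))

/-- Restriction to `ℤ_{≥1}`, encoded as truncation by zero, of a configuration with `f 0 = r`. -/
theorem FullConf.plusConf {k l r : ℕ} {f : ℤ → ℕ} (hf : FullConf k l f) (h0 : f 0 = r) :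
    PlusConf k (k - r) (fun m : ℤ => if 1 ≤ m then f m else 0) := by
  obtain ⟨hle, -, M, hM⟩ := hf
  refine ⟨fun m hm => if_neg (by omega), ?_, fun m hm => ?_, M, fun m hm => ?_⟩
  · have h := hle 0
    simp only [zero_add] at h
    simp only [le_refl, if_true]
    omega
  · simpa only [if_pos hm, if_pos (show 1 ≤ m + 1 by omega)] using hle m
  · simp [hM m hm]

/-- Restriction to `ℤ_{<0}`, encoded as truncation by zero, of a configuration with `f 0 = r`. -/
theorem FullConf.minusConf {k l r : ℕ} {f : ℤ → ℕ} (hf : FullConf k l f) (h0 : f 0 = r) :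
    MinusConf k l (k - r) (fun m : ℤ => if m < 0 then f m else 0) := by
  obtain ⟨hle, ⟨M, hM⟩, -⟩ := hf
  refine ⟨fun m hm => if_neg (by omega), ?_, fun m hm => ?_, min M (-1), fun m hm => ?_⟩
  · have h := hle (-1)
    simp only [neg_add_cancel] at h
    simp only [if_pos (show (-1 : ℤ) < 0 by omega)]
    omega
  · simpa only [if_pos (show m < 0 by omega), if_pos (show m + 1 < 0 by omega)] using hle m
  · simpa only [if_pos (show 2 * m < 0 by omega), if_pos (show 2 * m + 1 < 0 by omega)]
      using hM m (by omega)

/-- Gluing a configuration on `ℤ_{<0}`, the value `r` at `0` and a configuration on `ℤ_{≥1}`. -/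
theorem PlusConf.fullConf_glue {k l r : ℕ} (hr : r ≤ k) {g h : ℤ → ℕ}
    (hg : PlusConf k (k - r) g) (hh : MinusConf k l (k - r) h) :
    FullConf k l (fun m : ℤ => if m < 0 then h m else if m = 0 then r else g m) := by
  obtain ⟨-, hg1, hgle, M, hM⟩ := hg
  obtain ⟨-, hh1, hhle, N, hN⟩ := hh
  refine ⟨fun m => ?_, ⟨min N (-1), fun m hm => ?_⟩, max M 1, fun m hm => ?_⟩
  · rcases lt_or_ge m (-1) with hm | hm
    · simpa only [if_pos (show m < 0 by omega), if_pos (show m + 1 < 0 by omega)]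
        using hhle m (by omega)
    rcases lt_or_ge 0 m with hm' | hm'
    · simpa only [if_neg (show ¬ m < 0 by omega), if_neg (show ¬ m + 1 < 0 by omega),
        if_neg (show ¬ m = 0 by omega), if_neg (show ¬ m + 1 = 0 by omega)]
        using hgle m (by omega)
    obtain rfl | rfl : m = -1 ∨ m = 0 := by omega
    · simp
      omega
    · simp
      omega
  · simpa only [if_pos (show 2 * m < 0 by omega), if_pos (show 2 * m + 1 < 0 by omega)]
      using hN m (by omega)
  · simpa only [if_neg (show ¬ m < 0 by omega), if_neg (show ¬ m = 0 by omega)]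
      using hM m (by omega)

/-- The weight only sees the two truncations, since the site `0` contributes `0`. -/
theorem wFull_eq_wPlus_add_wMinus (k l : ℕ) (f : ℤ → ℕ) :
    wFull k l f
      = wPlus (fun m : ℤ => if 1 ≤ m then f m else 0)
        + wMinus k l (fun m : ℤ => if m < 0 then f m else 0) := by
  have hodd : ∑ᶠ m ∈ {m : ℤ | m < 0}, (2 * m + 1) * ((k : ℤ) - (l : ℤ) - (f (2 * m + 1) : ℤ))
      = ∑ᶠ m ∈ {m : ℤ | m < 0}, (2 * m + 1) * ((k : ℤ) - (l : ℤ)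
        - ((if 2 * m + 1 < 0 then f (2 * m + 1) else 0 : ℕ) : ℤ)) :=
    finsum_mem_congr rfl fun m (hm : m < 0) => by rw [if_pos (show 2 * m + 1 < 0 by omega)]
  have heven : ∑ᶠ m ∈ {m : ℤ | m < 0}, (2 * m) * ((l : ℤ) - (f (2 * m) : ℤ))
      = ∑ᶠ m ∈ {m : ℤ | m < 0}, (2 * m) * ((l : ℤ)
        - ((if 2 * m < 0 then f (2 * m) else 0 : ℕ) : ℤ)) :=
    finsum_mem_congr rfl fun m (hm : m < 0) => by rw [if_pos (show 2 * m < 0 by omega)]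
  have hpos : ∑ᶠ m ∈ {m : ℤ | 0 ≤ m}, m * (f m : ℤ)
      = ∑ᶠ m ∈ {m : ℤ | 1 ≤ m}, m * ((if 1 ≤ m then f m else 0 : ℕ) : ℤ) := by
    refine finsum_congr fun m => ?_
    rcases lt_trichotomy m 0 with hm | rfl | hm
    · simp [show ¬ 0 ≤ m by omega, show ¬ 1 ≤ m by omega]
    · simp
    · simp [show 0 ≤ m by omega, show 1 ≤ m by omega]
  unfold wFull wPlus wMinus
  rw [hodd, heven, hpos]
  ring

/-- The restriction map `f ↦ (f|_{ℤ≥1}, f|_{ℤ<0})` (in the chosen encoding, restriction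
is truncation by zero outside the respective domain) is a bijection from
`{f ∈ Σ_{l,k} : f(0) = r}` onto `Σ_k^{+,k−r} × Σ_{l,k}^{−,k−r}`, and it is
weight-additive: `w(f) = w⁺(f|_{ℤ≥1}) + w⁻(f|_{ℤ<0})`. -/
theorem statement13 (k l r : ℕ) (hk : 1 ≤ k) (hl : l ≤ k) (hr : r ≤ k) :
    Set.BijOn
      (fun f : ℤ → ℕ =>
        ((fun m : ℤ => if 1 ≤ m then f m else 0), (fun m : ℤ => if m < 0 then f m else 0)))
      {f : ℤ → ℕ | FullConf k l f ∧ f 0 = r}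
      ({g : ℤ → ℕ | PlusConf k (k - r) g} ×ˢ {h : ℤ → ℕ | MinusConf k l (k - r) h}) ∧
    ∀ f ∈ {f : ℤ → ℕ | FullConf k l f ∧ f 0 = r},
      wFull k l f
        = wPlus (fun m : ℤ => if 1 ≤ m then f m else 0)
          + wMinus k l (fun m : ℤ => if m < 0 then f m else 0) := by
  refine ⟨⟨?_, ?_, ?_⟩, fun f _ => wFull_eq_wPlus_add_wMinus k l f⟩
  · rintro f ⟨hf, h0⟩
    exact ⟨hf.plusConf h0, hf.minusConf h0⟩
  · rintro f ⟨-, hf0⟩ f' ⟨-, hf0'⟩ heq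
    obtain ⟨hplus, hminus⟩ := Prod.mk.inj heq
    funext m
    rcases lt_trichotomy m 0 with hm | rfl | hm
    · simpa only [if_pos hm] using congrFun hminus m
    · rw [hf0, hf0']
    · simpa only [if_pos (show 1 ≤ m by omega)] using congrFun hplus m
  · rintro ⟨g, h⟩ ⟨hg, hh⟩
    refine ⟨_, ⟨PlusConf.fullConf_glue hr hg hh, by simp⟩, Prod.ext ?_ ?_⟩
    · funext m
      have := hg.1 m
      grind
    · funext m
      have := hh.1 m
      grind
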